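/- As n → ∞, the kernel built with the forward difference operator Δ satisfies lim_{n→∞} K_{n−1}^{(j,j)}(0,0) = (j! (1−μ)^{γ+2j} / (μ^j (γ)_j)) · ∑_{k=0}^∞ ((j+1)_k (γ+j)_k / (1)_k) · μ^k/k!, where the infinite series converges absolutely (it is the Gauss hypergeometric series ₂F₁(j+1, j+γ; 1; μ) with 0 < μ < 1). -/

import Mathlib

open Finset Filter Topology Polynomial

noncomputable section

/-- Pochhammer symbol `(a)_k = a(a+1)⋯(a+k−1)`. -/
def poch (a : ℝ) (k : ℕ) : ℝ := ∏ m ∈ Finset.range k, (a + m)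

/-- Falling factorial `[x]_k = x(x−1)⋯(x−k+1)`. -/
def fall (x : ℝ) (k : ℕ) : ℝ := ∏ m ∈ Finset.range k, (x - m)

/-- `⟨x⟩_i^k`: falling factorial for `i = 1`, Pochhammer symbol for `i = 2`. -/
def br (i : ℕ) (x : ℝ) (k : ℕ) : ℝ := if i = 1 then fall x k else poch x k

/-- Forward (`i = 1`) resp. backward (`i = 2`) difference operator `𝒟_i`. -/
def Dop (i : ℕ) (f : ℝ → ℝ) : ℝ → ℝ :=
  fun x => if i = 1 then f (x + 1) - f x else f x - f (x - 1)

/-- Iterated difference operator `𝒟_i^k`. -/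
def Dk (i k : ℕ) (f : ℝ → ℝ) : ℝ → ℝ := (Dop i)^[k] f

/-- Kronecker delta `δ_{i,m}` (real valued). -/
def kdelta (i m : ℕ) : ℝ := if i = m then 1 else 0

/-- The shift `x ± 1`: `x + 1` for `i = 1`, `x - 1` for `i = 2`. -/
def sh (i : ℕ) (x : ℝ) : ℝ := if i = 1 then x + 1 else x - 1

/-- Monic Meixner polynomial `M_n(x)`. -/
def MeixnerM (γ μ : ℝ) (n : ℕ) (x : ℝ) : ℝ :=
  poch γ n * (μ / (μ - 1)) ^ n *
    ∑ k ∈ Finset.range (n + 1),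
      poch (-(n : ℝ)) k * poch (-x) k / poch γ k * (1 - μ⁻¹) ^ k / (Nat.factorial k : ℝ)

/-- Meixner inner product `⟨p,q⟩ = ∑_{x≥0} p(x)q(x) μ^x (γ)_x / x!`. -/
def mIP (γ μ : ℝ) (p q : ℝ → ℝ) : ℝ :=
  ∑' x : ℕ, p x * q x * μ ^ x * poch γ x / (Nat.factorial x : ℝ)

/-- Squared Meixner norm `‖M_n‖²`. -/
def nrm2 (γ μ : ℝ) (n : ℕ) : ℝ := mIP γ μ (MeixnerM γ μ n) (MeixnerM γ μ n)

/-- Kernel `K_n^{(l,m)}(x,y)` for the operator `𝒟_i`. -/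
def Klm (γ μ : ℝ) (i l m n : ℕ) (x y : ℝ) : ℝ :=
  ∑ k ∈ Finset.range (n + 1),
    Dk i l (MeixnerM γ μ k) x * Dk i m (MeixnerM γ μ k) y / nrm2 γ μ k

/-- Sobolev inner product `⟨p,q⟩_λ = ⟨p,q⟩ + λ 𝒟_i^j p(α) 𝒟_i^j q(α)`. -/
def sIP (γ μ lam α : ℝ) (i j : ℕ) (p q : ℝ → ℝ) : ℝ :=
  mIP γ μ p q + lam * Dk i j p α * Dk i j q α

/-- `Q` is the monic Sobolev orthogonal polynomial of degree `n`. -/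
def IsSobolevOP (γ μ lam α : ℝ) (i j n : ℕ) (Q : Polynomial ℝ) : Prop :=
  Q.Monic ∧ Q.natDegree = n ∧
    ∀ p : Polynomial ℝ, p.degree < (n : WithBot ℕ) →
      sIP γ μ lam α i j (fun x => Q.eval x) (fun x => p.eval x) = 0

/-- Coefficient `a_n^{(k)}`. -/
def acoef (γ μ lam α : ℝ) (i j n k : ℕ) : ℝ :=
  -(lam * (Nat.factorial j : ℝ) * Dk i j (MeixnerM γ μ n) α * Dk i k (MeixnerM γ μ (n - 1)) α) /
    ((Nat.factorial k : ℝ) * nrm2 γ μ (n - 1) * (1 + lam * Klm γ μ i j j (n - 1) α α))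

/-- Coefficient `b_n^{(k)}`. -/
def bcoef (γ μ lam α : ℝ) (i j n k : ℕ) : ℝ :=
  lam * (Nat.factorial j : ℝ) * Dk i j (MeixnerM γ μ n) α * Dk i k (MeixnerM γ μ n) α /
    ((Nat.factorial k : ℝ) * nrm2 γ μ (n - 1) * (1 + lam * Klm γ μ i j j (n - 1) α α))

/-- Rational function `A_{1,n}(x)`. -/
def A1 (γ μ lam α : ℝ) (i j n : ℕ) (x : ℝ) : ℝ :=
  1 + (1 / br i (x - α) (j + 1)) *
    ∑ k ∈ Finset.range (j + 1), acoef γ μ lam α i j n k * br i (x - α) k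

/-- Rational function `B_{1,n}(x)`. -/
def B1 (γ μ lam α : ℝ) (i j n : ℕ) (x : ℝ) : ℝ :=
  (1 / br i (x - α) (j + 1)) *
    ∑ k ∈ Finset.range (j + 1), bcoef γ μ lam α i j n k * br i (x - α) k

/-- Meixner recurrence coefficient `α_n`. -/
def alphaR (γ μ : ℝ) (n : ℕ) : ℝ := ((n : ℝ) * (1 + μ) + μ * γ) / (1 - μ)

/-- Meixner recurrence coefficient `β_n`. -/
def betaR (γ μ : ℝ) (n : ℕ) : ℝ := (n : ℝ) * μ * ((n : ℝ) + γ - 1) / (1 - μ) ^ 2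

/-- Rational function `A_{2,n}(x)`. -/
def A2 (γ μ lam α : ℝ) (i j n : ℕ) (x : ℝ) : ℝ :=
  -(B1 γ μ lam α i j (n - 1) x) / betaR γ μ (n - 1)

/-- Rational function `B_{2,n}(x)`. -/
def B2 (γ μ lam α : ℝ) (i j n : ℕ) (x : ℝ) : ℝ :=
  A1 γ μ lam α i j (n - 1) x + A2 γ μ lam α i j n x * (alphaR γ μ (n - 1) - x)

/-- Rational function `C_{1,n}(x)`. -/
def C1 (γ μ lam α : ℝ) (i j n : ℕ) (x : ℝ) : ℝ :=
  (x + γ * kdelta i 1) * Dop i (A1 γ μ lam α i j n) x + (n : ℝ) * A1 γ μ lam α i j n (sh i x)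
    - ((n : ℝ) - 1) * ((n : ℝ) + γ - 2) * μ ^ kdelta i 2 * B1 γ μ lam α i j n (sh i x) /
        (betaR γ μ (n - 1) * (1 - μ))

/-- Rational function `D_{1,n}(x)`. -/
def D1 (γ μ lam α : ℝ) (i j n : ℕ) (x : ℝ) : ℝ :=
  (x + γ * kdelta i 1) * Dop i (B1 γ μ lam α i j n) x
    + ((n : ℝ) - 1) * B1 γ μ lam α i j n (sh i x)
    + ((n : ℝ) - 1) * ((n : ℝ) + γ - 2) * (x - alphaR γ μ (n - 1)) * μ ^ kdelta i 2 *
        B1 γ μ lam α i j n (sh i x) / (betaR γ μ (n - 1) * (1 - μ))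
    + (n : ℝ) * ((n : ℝ) + γ - 1) * μ ^ kdelta i 2 * A1 γ μ lam α i j n (sh i x) / (1 - μ)

/-- Rational function `C_{2,n}(x)`. -/
def C2 (γ μ lam α : ℝ) (i j n : ℕ) (x : ℝ) : ℝ :=
  -(D1 γ μ lam α i j (n - 1) x) / betaR γ μ (n - 1)

/-- Rational function `D_{2,n}(x)`. -/
def D2 (γ μ lam α : ℝ) (i j n : ℕ) (x : ℝ) : ℝ :=
  C1 γ μ lam α i j (n - 1) x + C2 γ μ lam α i j n x * (alphaR γ μ (n - 1) - x)

/-- `A_{m,n}(x)` for `m = 1, 2`. -/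
def Aa (γ μ lam α : ℝ) (i j n m : ℕ) (x : ℝ) : ℝ :=
  if m = 1 then A1 γ μ lam α i j n x else A2 γ μ lam α i j n x

/-- `B_{m,n}(x)` for `m = 1, 2`. -/
def Bb (γ μ lam α : ℝ) (i j n m : ℕ) (x : ℝ) : ℝ :=
  if m = 1 then B1 γ μ lam α i j n x else B2 γ μ lam α i j n x

/-- `C_{k,n}(x)` for `k = 1, 2`. -/
def Cc (γ μ lam α : ℝ) (i j n k : ℕ) (x : ℝ) : ℝ :=
  if k = 1 then C1 γ μ lam α i j n x else C2 γ μ lam α i j n x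

/-- `D_{k,n}(x)` for `k = 1, 2`. -/
def Dd (γ μ lam α : ℝ) (i j n k : ℕ) (x : ℝ) : ℝ :=
  if k = 1 then D1 γ μ lam α i j n x else D2 γ μ lam α i j n x

/-- `Λ_{m,n}^{(k)}(x) = (−1)^k (C_{k,n}(x) B_{m,n}(x) − A_{m,n}(x) D_{k,n}(x))`. -/
def Lam (γ μ lam α : ℝ) (i j n m k : ℕ) (x : ℝ) : ℝ :=
  (-1 : ℝ) ^ k * (Cc γ μ lam α i j n k x * Bb γ μ lam α i j n m x
    - Aa γ μ lam α i j n m x * Dd γ μ lam α i j n k x)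

/-- `Θ_n(x) = A_{1,n}(x) B_{2,n}(x) − B_{1,n}(x) A_{2,n}(x)`. -/
def Theta (γ μ lam α : ℝ) (i j n : ℕ) (x : ℝ) : ℝ :=
  A1 γ μ lam α i j n x * B2 γ μ lam α i j n x - B1 γ μ lam α i j n x * A2 γ μ lam α i j n x

/-- `Θ̃_n(x) = (x + γ δ_{i,1}) Θ_n(x)`. -/
def Thetatil (γ μ lam α : ℝ) (i j n : ℕ) (x : ℝ) : ℝ :=
  (x + γ * kdelta i 1) * Theta γ μ lam α i j n x

lemma poch_zero (a : ℝ) : poch a 0 = 1 := by simp [poch]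

lemma poch_succ (a : ℝ) (k : ℕ) : poch a (k + 1) = poch a k * (a + k) := by
  simp [poch, prod_range_succ]

lemma poch_add (a : ℝ) (i l : ℕ) : poch a (i + l) = poch a i * poch (a + i) l := by
  simp [poch, prod_range_add, add_assoc]

lemma poch_pos {a : ℝ} (ha : 0 < a) (k : ℕ) : 0 < poch a k :=
  prod_pos fun _ _ => by positivity

lemma poch_eq_eval (a : ℝ) (k : ℕ) : poch a k = (ascPochhammer ℝ k).eval a := by
  induction k with
  | zero => simp [poch_zero]
  | succ k ih => rw [poch_succ, ih, ascPochhammer_succ_eval]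

lemma poch_one (k : ℕ) : poch 1 k = k.factorial := by
  rw [poch_eq_eval, ascPochhammer_eval_one]

lemma fall_zero (x : ℝ) : fall x 0 = 1 := by simp [fall]

lemma fall_succ (x : ℝ) (k : ℕ) : fall x (k + 1) = fall x k * (x - k) := by
  simp [fall, prod_range_succ]

lemma fall_add_one_succ (x : ℝ) (k : ℕ) : fall (x + 1) (k + 1) = (x + 1) * fall x k := by
  rw [fall, prod_range_succ', mul_comm, fall]
  congr 1
  · simp
  · exact prod_congr rfl fun m _ => by push_cast; ring

lemma fall_eq_eval (x : ℝ) (k : ℕ) : fall x k = (descPochhammer ℝ k).eval x := by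
  induction k with
  | zero => simp [fall_zero]
  | succ k ih => rw [fall_succ, ih, descPochhammer_succ_eval]

lemma fall_natCast (n k : ℕ) : fall n k = n.descFactorial k := by
  rw [fall_eq_eval, descPochhammer_eval_eq_descFactorial]

lemma fall_zero_left (k : ℕ) : fall 0 k = if k = 0 then 1 else 0 := by
  rw [fall_eq_eval, descPochhammer_eval_zero]

lemma poch_neg (x : ℝ) (k : ℕ) : poch (-x) k = (-1) ^ k * fall x k := by
  induction k with
  | zero => simp [poch_zero, fall_zero]
  | succ k ih => rw [poch_succ, ih, fall_succ]; ring

/-- Expansion of the Meixner polynomial in falling factorials. -/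
lemma MeixnerM_eq_sum_fall (γ μ : ℝ) (n : ℕ) (x : ℝ) :
    MeixnerM γ μ n x = ∑ i ∈ range (n + 1),
      poch γ n * (μ / (μ - 1)) ^ n * (n.choose i * (1 - μ⁻¹) ^ i / poch γ i) * fall x i := by
  rw [MeixnerM, mul_sum]
  refine sum_congr rfl fun i _ => ?_
  have hf : (i.factorial : ℝ) ≠ 0 := by positivity
  have hs : (-1 : ℝ) ^ i * (-1) ^ i = 1 := by rw [← mul_pow]; simp
  rw [poch_neg, poch_neg, fall_natCast, Nat.descFactorial_eq_factorial_mul_choose]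
  push_cast
  field_simp
  linear_combination (poch γ n * (μ / (μ - 1)) ^ n * (1 - μ⁻¹) ^ i * n.choose i * fall x i /
    poch γ i) * hs

/-- Forward difference of a combination of falling factorials. -/
lemma Dop_sum_fall (a : ℕ → ℝ) (N : ℕ) :
    Dop 1 (fun x => ∑ i ∈ range (N + 1), a i * fall x i) =
      fun x => ∑ i ∈ range N, (a (i + 1) * (i + 1)) * fall x i := by
  funext x
  simp only [Dop, if_true]
  rw [← sum_sub_distrib, sum_range_succ']
  simp only [fall_zero, sub_self, add_zero]
  refine sum_congr rfl fun i _ => ?_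
  rw [fall_add_one_succ, fall_succ]
  ring

lemma Dk_sum_fall_zero (a : ℕ → ℝ) (N j : ℕ) :
    Dk 1 j (fun x => ∑ i ∈ range (N + 1 + j), a i * fall x i) 0 = a j * j.factorial := by
  induction j generalizing a with
  | zero => simp [Dk, fall_zero_left]
  | succ j ih =>
    have h := ih fun i => a (i + 1) * (i + 1)
    rw [Dk] at h ⊢
    rw [Function.iterate_succ_apply, ← add_assoc, Dop_sum_fall, h, Nat.factorial_succ]
    push_cast
    ring

lemma Dk_MeixnerM_zero (γ μ : ℝ) (n j : ℕ) :
    Dk 1 j (MeixnerM γ μ n) 0 =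
      poch γ n * (μ / (μ - 1)) ^ n * (n.choose j * (1 - μ⁻¹) ^ j / poch γ j) * j.factorial := by
  rw [← Dk_sum_fall_zero
    (fun i => poch γ n * (μ / (μ - 1)) ^ n * (n.choose i * (1 - μ⁻¹) ^ i / poch γ i)) n j]
  congr 1
  funext x
  rw [MeixnerM_eq_sum_fall]
  refine sum_subset (range_mono (by omega)) fun i _ hi => ?_
  rw [Nat.choose_eq_zero_of_lt (by simpa using hi)]
  simp

/-- Binomial series in terms of Pochhammer symbols. -/
lemma hasSum_poch (γ : ℝ) {μ : ℝ} (hμ0 : 0 < μ) (hμ1 : μ < 1) :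
    HasSum (fun y : ℕ => poch γ y * μ ^ y / (y.factorial : ℝ)) ((1 - μ) ^ (-γ)) := by
  have h := (Real.one_div_one_sub_rpow_hasFPowerSeriesOnBall_zero γ).hasSum (y := μ)
    (by simp [enorm_eq_nnnorm, ← NNReal.coe_lt_coe, abs_of_pos hμ0, hμ1])
  rw [zero_add, one_div, ← Real.rpow_neg (by linarith)] at h
  refine h.congr_fun fun y => ?_
  have hc := Ring.factorial_nsmul_multichoose_eq_ascPochhammer γ y
  rw [Ring.multichoose_eq, nsmul_eq_mul, ascPochhammer_smeval_eq_eval, ← poch_eq_eval] at hc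
  have hf : (y.factorial : ℝ) ≠ 0 := by positivity
  simp only [FormalMultilinearSeries.ofScalars_apply_eq, smul_eq_mul]
  rw [← hc]
  field_simp

lemma hasSum_fall_mul_poch {γ μ : ℝ} (hμ0 : 0 < μ) (hμ1 : μ < 1) (i l : ℕ) :
    HasSum (fun x : ℕ => fall x i * poch (x + γ) l * μ ^ x * poch γ x / (x.factorial : ℝ))
      (μ ^ i * poch γ (i + l) * (1 - μ) ^ (-(γ + i + l))) := by
  rw [← hasSum_nat_add_iff' i, sum_eq_zero, sub_zero]
  · refine ((hasSum_poch (γ + i + l) hμ0 hμ1).mul_left (μ ^ i * poch γ (i + l))).congr_fun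
      fun y => ?_
    have h1 : poch γ (y + i) * poch (((y + i : ℕ) : ℝ) + γ) l =
        poch γ (i + l) * poch (γ + i + l) y := by
      rw [add_comm _ γ, ← poch_add, add_assoc γ, ← Nat.cast_add, ← poch_add]
      congr 1
      omega
    have h2 : (y.factorial : ℝ) * fall (y + i : ℕ) i = ((y + i).factorial : ℝ) := by
      rw [fall_natCast]
      exact_mod_cast by simpa using Nat.factorial_mul_descFactorial (Nat.le_add_left i y)
    have h3 : ((y + i).factorial : ℝ) ≠ 0 := by positivity
    have h4 : (y.factorial : ℝ) ≠ 0 := by positivity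
    rw [div_eq_iff h3, ← h2]
    field_simp
    rw [pow_add]
    linear_combination (fall (y + i : ℕ) i * μ ^ y * μ ^ i) * h1
  · intro x hx
    rw [fall_natCast, Nat.descFactorial_of_lt (by simpa using hx)]
    simp

/-- The rising factorial `(x + γ)_l` as a polynomial in `x`. -/
def risingPoly (γ : ℝ) (l : ℕ) : ℝ[X] := (ascPochhammer ℝ l).comp (X + C γ)

lemma eval_risingPoly (γ : ℝ) (l : ℕ) (x : ℝ) : (risingPoly γ l).eval x = poch (x + γ) l := by
  simp [risingPoly, poch_eq_eval]

lemma monic_risingPoly (γ : ℝ) (l : ℕ) : (risingPoly γ l).Monic :=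
  (monic_ascPochhammer ℝ l).comp_X_add_C γ

lemma natDegree_risingPoly (γ : ℝ) (l : ℕ) : (risingPoly γ l).natDegree = l := by
  rw [risingPoly, natDegree_comp, ascPochhammer_natDegree, natDegree_X_add_C, mul_one]

lemma alternating_sum_choose_mul_poch (γ : ℝ) {l n : ℕ} (hl : l ≤ n) :
    ∑ i ∈ range (n + 1), (-1 : ℝ) ^ i * n.choose i * poch (i + γ) l =
      if l = n then (-1) ^ n * (n.factorial : ℝ) else 0 := by
  have h := fwdDiff_iter_eq_sum_shift (1 : ℝ) (risingPoly γ l).eval n 0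
  have hd : (fwdDiff (1 : ℝ))^[n] (risingPoly γ l).eval 0 =
      if l = n then (n.factorial : ℝ) else 0 := by
    split_ifs with hln
    · have := congrFun (risingPoly γ l).fwdDiff_iter_degree_eq_factorial 0
      rw [natDegree_risingPoly, (monic_risingPoly γ l).leadingCoeff, hln] at this
      simpa [hln] using this
    · rw [Polynomial.fwdDiff_iter_eq_zero_of_degree_lt]
      · rfl
      · rw [natDegree_risingPoly]; omega
  rw [hd] at h
  rw [← mul_ite_zero, h, mul_sum]
  refine sum_congr rfl fun i hi => ?_
  have hs : (-1 : ℝ) ^ n * (-1) ^ (n - i) = (-1) ^ i := by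
    obtain ⟨m, rfl⟩ := Nat.exists_eq_add_of_le (Nat.lt_succ_iff.mp (mem_range.mp hi))
    rw [Nat.add_sub_cancel_left, pow_add, mul_assoc, ← mul_pow]
    simp
  rw [← hs, eval_risingPoly]
  simp [mul_assoc]

lemma hasSum_MeixnerM_mul_poch {γ μ : ℝ} (hγ : 0 < γ) (hμ0 : 0 < μ) (hμ1 : μ < 1) {l n : ℕ}
    (hl : l ≤ n) :
    HasSum (fun x : ℕ =>
        poch (x + γ) l * MeixnerM γ μ n x * μ ^ x * poch γ x / (x.factorial : ℝ))
      (if l = n then n.factorial * poch γ n * μ ^ n / (1 - μ) ^ (γ + 2 * n) else 0) := by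
  have h := hasSum_sum (s := range (n + 1)) fun i (_ : i ∈ range (n + 1)) =>
    (hasSum_fall_mul_poch (γ := γ) hμ0 hμ1 i l).mul_left
      (poch γ n * (μ / (μ - 1)) ^ n * (n.choose i * (1 - μ⁻¹) ^ i / poch γ i))
  have hpos : 0 < 1 - μ := by linarith
  have ht : ∀ i ∈ range (n + 1),
      poch γ n * (μ / (μ - 1)) ^ n * (n.choose i * (1 - μ⁻¹) ^ i / poch γ i) *
        (μ ^ i * poch γ (i + l) * (1 - μ) ^ (-(γ + i + l))) =
      poch γ n * (μ / (μ - 1)) ^ n * (1 - μ) ^ (-(γ + l)) *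
        ((-1 : ℝ) ^ i * n.choose i * poch (i + γ) l) := by
    intro i _
    have hp := (poch_pos hγ i).ne'
    have hv : (1 - μ) ^ i ≠ 0 := by positivity
    have e1 : (1 - μ) ^ (-(γ + i + l)) = (1 - μ) ^ (-(γ + l)) / (1 - μ) ^ i := by
      rw [← Real.rpow_natCast, ← Real.rpow_sub hpos]
      congr 1
      ring
    have e2 : (1 - μ⁻¹) ^ i = (-1) ^ i * (1 - μ) ^ i / μ ^ i := by
      rw [← mul_pow, ← div_pow]
      congr 1
      field_simp
      ring
    rw [e1, e2, poch_add, add_comm γ (i : ℝ)]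
    field_simp
  rw [sum_congr rfl ht, ← mul_sum, alternating_sum_choose_mul_poch γ hl, mul_ite, mul_zero] at h
  have hval : poch γ n * (μ / (μ - 1)) ^ n * (1 - μ) ^ (-(γ + l)) * ((-1) ^ n * n.factorial) =
      n.factorial * poch γ n * μ ^ n / (1 - μ) ^ (γ + l + n) := by
    have e3 : (1 - μ) ^ (γ + l + n) = (1 - μ) ^ (γ + l) * (1 - μ) ^ n := by
      rw [← Real.rpow_natCast, ← Real.rpow_add hpos]
    have e4 : (μ - 1) ^ n = (-1) ^ n * (1 - μ) ^ n := by
      rw [← mul_pow]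
      congr 1
      ring
    have e5 : (1 - μ) ^ (γ + l) ≠ 0 := (Real.rpow_pos_of_pos hpos _).ne'
    have hs : (-1 : ℝ) ^ n ≠ 0 := by simp
    rw [e3, Real.rpow_neg hpos.le, div_pow, e4]
    field_simp
  have hexp : l = n → γ + (l : ℝ) + n = γ + 2 * n := by
    rintro rfl
    ring
  rw [hval, ite_congr rfl (fun hln => by rw [hexp hln]) fun _ => rfl] at h
  refine h.congr_fun fun x => ?_
  rw [MeixnerM_eq_sum_fall, mul_sum, sum_mul, sum_mul, sum_div]
  exact sum_congr rfl fun i _ => by ring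

/-- Pairing of the Meixner polynomial of degree `n` with polynomials of degree at most `n`. -/
lemma hasSum_eval_mul_MeixnerM {γ μ : ℝ} (hγ : 0 < γ) (hμ0 : 0 < μ) (hμ1 : μ < 1) {d n : ℕ}
    (hd : d ≤ n + 1) (p : ℝ[X]) (hp : p.degree < d) :
    HasSum (fun x : ℕ => p.eval (x : ℝ) * MeixnerM γ μ n x * μ ^ x * poch γ x /
        (x.factorial : ℝ))
      (p.coeff n * (n.factorial * poch γ n * μ ^ n / (1 - μ) ^ (γ + 2 * n))) := by
  induction d generalizing p with
  | zero =>
    have : p = 0 := by simpa using hp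
    simp [this, hasSum_zero]
  | succ d ih =>
    have hdn : d ≤ n := by omega
    have hR : ∀ m, d ≤ m → (risingPoly γ d).coeff m = if d = m then 1 else 0 := by
      intro m hm
      split_ifs with h
      · subst h
        simpa [natDegree_risingPoly] using (monic_risingPoly γ d).coeff_natDegree
      · exact coeff_eq_zero_of_natDegree_lt (by rw [natDegree_risingPoly]; omega)
    have hq : (p - C (p.coeff d) * risingPoly γ d).degree < d := by
      rw [degree_lt_iff_coeff_zero]
      intro m hm
      rw [coeff_sub, coeff_C_mul, hR m hm]
      split_ifs with h
      · simp [h]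
      · rw [degree_lt_iff_coeff_zero] at hp
        simp [hp m (by omega)]
    have h := (ih (by omega) _ hq).add
      ((hasSum_MeixnerM_mul_poch hγ hμ0 hμ1 hdn).mul_left (p.coeff d))
    rw [coeff_sub, coeff_C_mul, hR n hdn] at h
    convert h using 1
    · funext x
      rw [eval_sub, eval_C_mul, eval_risingPoly]
      ring
    · split_ifs <;> ring

lemma nrm2_eq {γ μ : ℝ} (hγ : 0 < γ) (hμ0 : 0 < μ) (hμ1 : μ < 1) (n : ℕ) :
    nrm2 γ μ n = n.factorial * poch γ n * μ ^ n / (1 - μ) ^ (γ + 2 * n) := by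
  let a : ℕ → ℝ := fun i =>
    poch γ n * (μ / (μ - 1)) ^ n * (n.choose i * (1 - μ⁻¹) ^ i / poch γ i)
  let p : ℝ[X] := ∑ i ∈ range (n + 1), C (a i) * descPochhammer ℝ i
  have hev : ∀ x, p.eval x = MeixnerM γ μ n x := fun x => by
    rw [MeixnerM_eq_sum_fall, eval_finsetSum]
    exact sum_congr rfl fun i _ => by rw [eval_C_mul, fall_eq_eval]
  have hdeg : p.degree < (n + 1 : ℕ) := by
    refine (degree_sum_le _ _).trans_lt ((Finset.sup_lt_iff (WithBot.bot_lt_coe _)).2 fun i hi => ?_)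
    refine lt_of_le_of_lt (degree_le_of_natDegree_le (n := i) ?_)
      (by exact_mod_cast mem_range.mp hi)
    exact (natDegree_C_mul_le _ _).trans (descPochhammer_natDegree ℝ i).le
  have hcoeff : p.coeff n = 1 := by
    have hlow : ∀ i ∈ range n, (C (a i) * descPochhammer ℝ i).coeff n = 0 := fun i hi => by
      rw [coeff_C_mul, coeff_eq_zero_of_natDegree_lt, mul_zero]
      rw [descPochhammer_natDegree]
      exact mem_range.mp hi
    have hlead : (descPochhammer ℝ n).coeff n = 1 := by
      simpa [descPochhammer_natDegree] using (monic_descPochhammer ℝ n).coeff_natDegree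
    have hc : (1 - μ⁻¹) = (μ - 1) / μ := by field_simp
    have hμ' : μ - 1 ≠ 0 := by linarith
    have hp := (poch_pos hγ n).ne'
    rw [finsetSum_coeff, sum_range_succ, sum_eq_zero hlow, coeff_C_mul, hlead]
    simp only [a, hc, Nat.choose_self]
    field_simp
    rw [Nat.cast_one, mul_one, zero_add, ← mul_pow, div_mul_div_cancel₀ hμ', div_self hμ0.ne',
      one_pow]
  have h := (hasSum_eval_mul_MeixnerM hγ hμ0 hμ1 le_rfl p hdeg).tsum_eq
  rw [hcoeff, one_mul] at h
  simpa only [hev, nrm2, mIP] using h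

/-- Each summand of the kernel is a multiple of a term of `₂F₁(j + 1, γ + j; 1; μ)`. -/
lemma kernel_term_eq {γ μ : ℝ} (hγ : 0 < γ) (hμ0 : 0 < μ) (hμ1 : μ < 1) (j m : ℕ) :
    Dk 1 j (MeixnerM γ μ (m + j)) 0 * Dk 1 j (MeixnerM γ μ (m + j)) 0 / nrm2 γ μ (m + j) =
      j.factorial * (1 - μ) ^ (γ + 2 * j) / (μ ^ j * poch γ j) *
        (poch (j + 1) m * poch (γ + j) m / poch 1 m * μ ^ m / m.factorial) := by
  have hpos : 0 < 1 - μ := by linarith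
  have e1 : (1 - μ) ^ (γ + 2 * (m + j : ℕ)) = (1 - μ) ^ (γ + 2 * j) * (1 - μ) ^ (2 * m) := by
    rw [← Real.rpow_natCast, ← Real.rpow_add hpos]
    congr 1
    push_cast
    ring
  have e2 : (1 - μ⁻¹) = (-1) * (1 - μ) / μ := by
    field_simp
    ring
  have e3 : μ - 1 = (-1) * (1 - μ) := by ring
  have e4 : ((m + j).factorial : ℝ) = j.factorial * poch (j + 1) m := by
    rw [poch_eq_eval, factorial_mul_ascPochhammer, add_comm]
  have e5 : ((m + j).choose j : ℝ) = poch (j + 1) m / m.factorial := by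
    rw [Nat.cast_choose ℝ (Nat.le_add_left j m), Nat.add_sub_cancel, e4]
    field_simp
  have hs : (-1 : ℝ) ^ m ≠ 0 := by simp
  have hr := (Real.rpow_pos_of_pos hpos (γ + 2 * j)).ne'
  have hp1 := (poch_pos hγ j).ne'
  have hp2 := (poch_pos (show 0 < γ + j by positivity) m).ne'
  have hp3 := (poch_pos (show (0 : ℝ) < j + 1 by positivity) m).ne'
  rw [Dk_MeixnerM_zero, nrm2_eq hγ hμ0 hμ1, e1, e2, e3, e4, e5, poch_one, add_comm m j, poch_add,
    div_pow, div_pow, mul_pow, mul_pow, pow_add, pow_add, pow_add]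
  field_simp
  rw [← pow_mul (-1 : ℝ), mul_comm m 2, pow_mul (-1 : ℝ) 2, neg_one_sq, one_pow, one_mul, pow_mul']

lemma summable_hypergeometric {a b μ : ℝ} (ha : 0 < a) (hb : 0 < b) (hμ0 : 0 < μ) (hμ1 : μ < 1) :
    Summable fun k : ℕ => poch a k * poch b k / poch 1 k * μ ^ k / (k.factorial : ℝ) := by
  have hpos : ∀ k : ℕ, 0 < poch a k * poch b k / poch 1 k * μ ^ k / (k.factorial : ℝ) := fun k => by
    have := poch_pos ha k
    have := poch_pos hb k
    have := poch_pos one_pos k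
    positivity
  refine summable_of_ratio_test_tendsto_lt_one hμ1 (.of_forall fun k => (hpos k).ne') ?_
  have hlim : ∀ c : ℝ, Tendsto (fun k : ℕ => (c + k) / (1 + k)) atTop (𝓝 1) := fun c => by
    simpa using tendsto_add_mul_div_add_mul_atTop_nhds c 1 1 (one_ne_zero' ℝ)
  have := ((hlim a).mul (hlim b)).mul_const μ
  rw [one_mul, one_mul] at this
  refine this.congr fun k => ?_
  have h1 := (poch_pos ha k).ne'
  have h2 := (poch_pos hb k).ne'
  rw [Real.norm_of_nonneg (hpos _).le, Real.norm_of_nonneg (hpos _).le, poch_one, poch_one,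
    poch_succ, poch_succ, Nat.factorial_succ, pow_succ]
  push_cast
  field_simp
  ring

/-- limit of the kernel `K_{n−1}^{(j,j)}(0,0)` as `n → ∞`. -/
theorem kernel_jj_limit (γ μ : ℝ) (hγ : 0 < γ) (hμ0 : 0 < μ) (hμ1 : μ < 1) (j : ℕ) :
    Summable (fun k : ℕ =>
      poch ((j : ℝ) + 1) k * poch (γ + (j : ℝ)) k / poch 1 k * μ ^ k /
        (Nat.factorial k : ℝ)) ∧
    Tendsto (fun n : ℕ => Klm γ μ 1 j j (n - 1) 0 0) atTop
      (𝓝 ((Nat.factorial j : ℝ) * (1 - μ) ^ (γ + 2 * (j : ℝ)) / (μ ^ j * poch γ j) *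
        ∑' k : ℕ,
          poch ((j : ℝ) + 1) k * poch (γ + (j : ℝ)) k / poch 1 k * μ ^ k /
            (Nat.factorial k : ℝ))) := by
  have hsum := summable_hypergeometric (a := (j : ℝ) + 1) (b := γ + j) (by positivity)
    (by positivity) hμ0 hμ1
  refine ⟨hsum, ?_⟩
  have hlow : ∀ i ∈ range j, Dk 1 j (MeixnerM γ μ i) 0 * Dk 1 j (MeixnerM γ μ i) 0 /
      nrm2 γ μ i = 0 := fun i hi => by
    rw [Dk_MeixnerM_zero, Nat.choose_eq_zero_of_lt (mem_range.mp hi)]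
    simp
  have hterm := (hasSum_nat_add_iff (f := fun k => Dk 1 j (MeixnerM γ μ k) 0 *
    Dk 1 j (MeixnerM γ μ k) 0 / nrm2 γ μ k) j).mp
    ((hsum.hasSum.mul_left _).congr_fun fun m => kernel_term_eq hγ hμ0 hμ1 j m)
  rw [sum_eq_zero hlow, add_zero] at hterm
  have h := hterm.tendsto_sum_nat
  refine h.congr' ?_
  filter_upwards [eventually_ge_atTop 1] with n hn
  rw [Klm, Nat.sub_add_cancel hn]
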